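/- Let a > 0 and let V : ℝ → ℂ be continuous with ∫_ℝ e^{4a|x|}|V(x)|² dx < ∞. Let U = {t ∈ ℂ : |Re t| < a}, and suppose ν₁, ν₂ : ℝ × U → ℂ are such that: for each t ∈ U, x ↦ νᵢ(x,t) is a twice continuously differentiable solution of μ'' + (−t² − V(x))μ = 0 with ν₁(0,t) = 1, ∂ₓν₁(0,t) = 0, ν₂(0,t) = 0, ∂ₓν₂(0,t) = 1; νᵢ and ∂ₓνᵢ are continuous on ℝ × U and holomorphic in t for each fixed x; and for every compact K ⊂ U there exist constants C_K and b_K with b_K < 2a − sup_{t∈K}|Re t| such that |νᵢ(x,t)| + |∂ₓνᵢ(x,t)| ≤ C_K e^{b_K|x|} for all x ∈ ℝ and t ∈ K. Then the function t ↦ 𝔻(−t², ν₁(·,t), ν₂(·,t)) is holomorphic on {t ∈ ℂ : |Re t| < a, t ≠ 0}. (Equivalently, 𝔻(λ, ν₁, ν₂) is holomorphic in λ on the Riemann surface P(a) = {λ : −a < Im √λ < a} minus the branch point.) -/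

import Mathlib

open MeasureTheory Set Filter

/-- `D t V μ x = μ(x) + (1/(2t)) ∫_x^∞ e^{-t(y-x)} V(y) μ(y) dy
    + (1/(2t)) ∫_{-∞}^x e^{t(y-x)} V(y) μ(y) dy`, where `t = √(-λ)`. -/
noncomputable def D (t : ℂ) (V μ : ℝ → ℂ) (x : ℝ) : ℂ :=
  μ x + (1 / (2 * t)) * (∫ y in Ici x, Complex.exp (-t * ((y : ℂ) - (x : ℂ))) * V y * μ y)
      + (1 / (2 * t)) * (∫ y in Iic x, Complex.exp (t * ((y : ℂ) - (x : ℂ))) * V y * μ y)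

/-- `𝔻(λ, μ₁, μ₂) = D(0,λ,μ₁) D'(0,λ,μ₂) - D'(0,λ,μ₁) D(0,λ,μ₂)`. -/
noncomputable def DD (t : ℂ) (V μ₁ μ₂ : ℝ → ℂ) : ℂ :=
  D t V μ₁ 0 * deriv (D t V μ₂) 0 - deriv (D t V μ₁) 0 * D t V μ₂ 0

/-- A parametric integral of holomorphic functions is holomorphic if the integrand is, near each
point, dominated by an integrable function. -/
theorem differentiableOn_integral_of_locally_dominated {α : Type*} [MeasurableSpace α]
    {μ : Measure α} {U : Set ℂ} {F : ℂ → α → ℂ}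
    (hmeas : ∀ z ∈ U, AEStronglyMeasurable (F z) μ)
    (hdiff : ∀ x, DifferentiableOn ℂ (fun z => F z x) U)
    (hbound : ∀ z ∈ U, ∃ r > 0, Metric.closedBall z r ⊆ U ∧ ∃ g : α → ℝ, Integrable g μ ∧
      ∀ w ∈ Metric.closedBall z r, ∀ x, ‖F w x‖ ≤ g x) :
    DifferentiableOn ℂ (fun z => ∫ x, F z x ∂μ) U := by
  intro z hz
  obtain ⟨r, hr, hrU, g, hg, hFg⟩ := hbound z hz
  have hderiv : ∀ x, ∀ w ∈ Metric.ball z r, HasDerivAt (fun z => F z x)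
      (deriv (fun z => F z x) w) w := fun x w hw =>
    ((hdiff x).differentiableAt (Filter.mem_of_superset (Metric.isOpen_ball.mem_nhds hw)
      (Metric.ball_subset_closedBall.trans hrU))).hasDerivAt
  have hball : Metric.ball z (r / 2) ⊆ Metric.ball z r := Metric.ball_subset_ball (by linarith)
  refine (hasDerivAt_integral_of_dominated_loc_of_deriv_le
    (F' := fun w x => deriv (fun z => F z x) w) (bound := fun x => g x / (r / 2))
    (Metric.ball_mem_nhds z (half_pos hr)) ?_ ?_ ?_ ?_ (hg.div_const _)
    ?_).2.differentiableAt.differentiableWithinAt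
  · filter_upwards [Metric.ball_mem_nhds z hr] with w hw
    exact hmeas w (hrU (Metric.ball_subset_closedBall hw))
  · exact hg.mono' (hmeas z hz) (.of_forall fun x => hFg z (Metric.mem_closedBall_self hr.le) x)
  · obtain ⟨h, -, hpos, hlim⟩ := exists_seq_strictAnti_tendsto' hr
    have hne : Tendsto (fun n => (h n : ℂ)) atTop (nhdsWithin 0 {0}ᶜ) := by
      refine tendsto_nhdsWithin_iff.2 ⟨?_, .of_forall fun n => ?_⟩
      · simpa [Function.comp_def] using (Complex.continuous_ofReal.tendsto 0).comp hlim
      · simpa using (hpos n).1.ne'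
    refine aestronglyMeasurable_of_tendsto_ae atTop
      (f := fun n x => (h n : ℂ)⁻¹ • (F (z + h n) x - F z x)) (fun n => ?_)
      (.of_forall fun x => (hderiv x z (Metric.mem_ball_self hr)).tendsto_slope_zero.comp hne)
    refine AEStronglyMeasurable.fun_const_smul ((hmeas _ (hrU ?_)).sub (hmeas z hz)) _
    simpa [abs_of_pos (hpos n).1] using (hpos n).2.le
  · refine .of_forall fun x w hw => ?_
    have hsub : Metric.closedBall w (r / 2) ⊆ Metric.closedBall z r := by
      refine Metric.closedBall_subset_closedBall' ?_
      have := Metric.mem_ball.1 hw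
      linarith
    refine Complex.norm_deriv_le_of_forall_mem_sphere_norm_le (half_pos hr) ?_
      fun v hv => hFg v (hsub (Metric.sphere_subset_closedBall hv)) x
    refine ((hdiff x).mono ?_).diffContOnCl
    exact (Metric.closure_ball_subset_closedBall.trans hsub).trans hrU
  · exact .of_forall fun x w hw => hderiv x w (hball hw)

theorem integrable_exp_mul_abs {c : ℝ} (hc : c < 0) :
    Integrable fun x : ℝ => Real.exp (c * |x|) := by
  rw [← integrableOn_univ, ← Iic_union_Ioi (a := (0 : ℝ))]
  refine IntegrableOn.union ?_ ?_
  · refine (integrableOn_exp_mul_Iic (neg_pos.2 hc) 0).congr_fun (fun x hx => ?_) measurableSet_Iic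
    simp [abs_of_nonpos (mem_Iic.1 hx)]
  · refine (integrableOn_exp_mul_Ioi hc 0).congr_fun (fun x hx => ?_) measurableSet_Ioi
    simp [abs_of_pos (mem_Ioi.1 hx)]

/-- If `e^{k|x|} V` is square integrable, then `e^{m|x|} V` is integrable for `m < k`. -/
theorem integrable_exp_mul_abs_mul_norm {k m : ℝ} (hmk : m < k) {V : ℝ → ℂ} (hV : Continuous V)
    (hVL2 : Integrable fun x : ℝ => Real.exp (2 * k * |x|) * ‖V x‖ ^ 2) :
    Integrable fun x : ℝ => Real.exp (m * |x|) * ‖V x‖ := by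
  have hc : 2 * (m - k) < 0 := by linarith
  refine (hVL2.add (integrable_exp_mul_abs hc)).mono'
    (by fun_prop : Continuous _).aestronglyMeasurable (.of_forall fun x => ?_)
  have h₁ : Real.exp (2 * k * |x|) = Real.exp (k * |x|) ^ 2 := by
    rw [← Real.exp_nat_mul]; ring_nf
  have h₂ : Real.exp (2 * (m - k) * |x|) = Real.exp ((m - k) * |x|) ^ 2 := by
    rw [← Real.exp_nat_mul]; ring_nf
  have h₃ : Real.exp (m * |x|) = Real.exp (k * |x|) * Real.exp ((m - k) * |x|) := by
    rw [← Real.exp_add]; ring_nf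
  have h₀ : 0 ≤ Real.exp (m * |x|) * ‖V x‖ := by positivity
  rw [Real.norm_of_nonneg h₀]
  simp only [Pi.add_apply]
  rw [h₁, h₂, h₃]
  nlinarith [sq_nonneg (Real.exp (k * |x|) * ‖V x‖ - Real.exp ((m - k) * |x|)),
    sq_nonneg (Real.exp (k * |x|) * ‖V x‖ + Real.exp ((m - k) * |x|))]

theorem hasDerivAt_integral_Iic {f : ℝ → ℂ} (hf : Continuous f) (hfi : Integrable f) (x : ℝ) :
    HasDerivAt (fun u => ∫ y in Iic u, f y) (f x) x := by
  have h : (fun u => ∫ y in Iic u, f y) = fun u => (∫ y in (0 : ℝ)..u, f y) + ∫ y in Iic 0, f y := by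
    ext u
    rw [← intervalIntegral.integral_Iic_sub_Iic hfi.integrableOn hfi.integrableOn, sub_add_cancel]
  rw [h]
  exact (intervalIntegral.integral_hasDerivAt_right (hf.intervalIntegrable _ _)
    hf.stronglyMeasurable.stronglyMeasurableAtFilter hf.continuousAt).add_const _

theorem hasDerivAt_integral_Ici {f : ℝ → ℂ} (hf : Continuous f) (hfi : Integrable f) (x : ℝ) :
    HasDerivAt (fun u => ∫ y in Ici u, f y) (-f x) x := by
  have h : (fun u => ∫ y in Ici u, f y) = fun u => (∫ y, f y) - ∫ y in Iic u, f y := by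
    ext u
    rw [integral_Ici_eq_integral_Ioi, ← intervalIntegral.integral_Iic_add_Ioi (b := u)
      hfi.integrableOn hfi.integrableOn, add_sub_cancel_left]
  rw [h]
  exact (hasDerivAt_integral_Iic hf hfi x).const_sub _

theorem D_zero (t : ℂ) (V μ : ℝ → ℂ) :
    D t V μ 0 = μ 0 + (1 / (2 * t)) * (∫ y in Ici (0 : ℝ), Complex.exp (-t * y) * V y * μ y)
      + (1 / (2 * t)) * (∫ y in Iic (0 : ℝ), Complex.exp (t * y) * V y * μ y) := by
  simp [D]

theorem deriv_D_zero {t : ℂ} (ht : t ≠ 0) {V μ : ℝ → ℂ} (hV : Continuous V)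
    (hμ : Differentiable ℝ μ)
    (hneg : Integrable fun y : ℝ => Complex.exp (-t * y) * V y * μ y)
    (hpos : Integrable fun y : ℝ => Complex.exp (t * y) * V y * μ y) :
    deriv (D t V μ) 0 = deriv μ 0
      + (1 / 2) * (∫ y in Ici (0 : ℝ), Complex.exp (-t * y) * V y * μ y)
      - (1 / 2) * (∫ y in Iic (0 : ℝ), Complex.exp (t * y) * V y * μ y) := by
  have hμc := hμ.continuous
  have hD : D t V μ = fun x => μ x
      + (1 / (2 * t)) * (Complex.exp (t * x) * ∫ y in Ici x, Complex.exp (-t * y) * V y * μ y)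
      + (1 / (2 * t)) * (Complex.exp (-t * x) * ∫ y in Iic x, Complex.exp (t * y) * V y * μ y) := by
    ext x
    have hsplit : ∀ s y : ℂ, Complex.exp (s * (y - x)) =
        Complex.exp (-s * x) * Complex.exp (s * y) := fun s y => by
      rw [← Complex.exp_add]; ring_nf
    simp only [D, hsplit, neg_neg, mul_assoc, integral_const_mul]
  have hexp : ∀ s : ℂ, HasDerivAt (fun x : ℝ => Complex.exp (s * x)) s 0 := fun s => by
    simpa using ((Complex.ofRealCLM.hasDerivAt (x := (0 : ℝ))).const_mul s).cexp
  have h₁ := (hexp t).mul (hasDerivAt_integral_Ici (by fun_prop) hneg 0)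
  have h₂ := (hexp (-t)).mul (hasDerivAt_integral_Iic (by fun_prop) hpos 0)
  have h := (((hμ 0).hasDerivAt.add (h₁.const_mul (1 / (2 * t)))).add
    (h₂.const_mul (1 / (2 * t)))).deriv
  rw [hD]
  refine Eq.trans h ?_
  simp only [Complex.ofReal_zero, mul_zero, Complex.exp_zero]
  field_simp
  ring

/-- The function `t ↦ ∫_S e^{σty} V(y) ν(y,t) dy` is holomorphic in the strip. -/
theorem differentiableOn_integral_exp_mul {a : ℝ} {V : ℝ → ℂ} (hV : Continuous V)
    (hVL2 : Integrable fun x : ℝ => Real.exp (4 * a * |x|) * ‖V x‖ ^ 2) {ν : ℝ → ℂ → ℂ}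
    (hcont : ∀ t : ℂ, |t.re| < a → Continuous fun x => ν x t)
    (hhol : ∀ x, DifferentiableOn ℂ (ν x) {t : ℂ | |t.re| < a})
    (hbound : ∀ K : Set ℂ, K ⊆ {t : ℂ | |t.re| < a} → IsCompact K →
      ∃ C b : ℝ, (∀ t ∈ K, b < 2 * a - |t.re|) ∧
        ∀ x : ℝ, ∀ t ∈ K, ‖ν x t‖ ≤ C * Real.exp (b * |x|))
    (σ : ℝ) (hσ : |σ| = 1) (S : Set ℝ) :
    (∀ t : ℂ, |t.re| < a → Integrable fun y : ℝ => Complex.exp (σ * t * y) * V y * ν y t) ∧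
    DifferentiableOn ℂ (fun t => ∫ y in S, Complex.exp (σ * t * y) * V y * ν y t)
      {t : ℂ | |t.re| < a} := by
  have hopen : IsOpen {t : ℂ | |t.re| < a} :=
    isOpen_lt (by fun_prop) continuous_const
  have hmeas : ∀ t : ℂ, |t.re| < a →
      Continuous fun y : ℝ => Complex.exp (σ * t * y) * V y * ν y t := fun t ht => by
    have := hcont t ht
    fun_prop
  have hdom : ∀ t : ℂ, |t.re| < a → ∃ r > 0, Metric.closedBall t r ⊆ {t : ℂ | |t.re| < a} ∧
      ∃ g : ℝ → ℝ, Integrable g ∧ ∀ w ∈ Metric.closedBall t r, ∀ y : ℝ,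
        ‖Complex.exp (σ * w * y) * V y * ν y w‖ ≤ g y := by
    intro t ht
    obtain ⟨r, hr, hrU⟩ := Metric.nhds_basis_closedBall.mem_iff.1 (hopen.mem_nhds ht)
    have hK := isCompact_closedBall t r
    obtain ⟨C, b, hb, hν⟩ := hbound _ hrU hK
    obtain ⟨w₀, hw₀, hmax⟩ := hK.exists_isMaxOn ⟨t, Metric.mem_closedBall_self hr.le⟩
      (f := fun w : ℂ => |w.re|) (by fun_prop)
    have hm : |w₀.re| + b < 2 * a := by linarith [hb w₀ hw₀]
    refine ⟨r, hr, hrU, _, (integrable_exp_mul_abs_mul_norm hm hV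
      (by convert hVL2 using 4; ring)).const_mul C, fun w hw y => ?_⟩
    have hexp : ‖Complex.exp (σ * w * y)‖ ≤ Real.exp (|w₀.re| * |y|) := by
      rw [Complex.norm_exp, Real.exp_le_exp]
      have hre : (σ * w * y : ℂ).re = σ * w.re * y := by simp
      calc (σ * w * y : ℂ).re = σ * w.re * y := hre
        _ ≤ |σ * w.re * y| := le_abs_self _
        _ = |w.re| * |y| := by rw [abs_mul, abs_mul, hσ, one_mul]
        _ ≤ |w₀.re| * |y| := by exact mul_le_mul_of_nonneg_right (hmax hw) (abs_nonneg y)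
    calc ‖Complex.exp (σ * w * y) * V y * ν y w‖
        = ‖Complex.exp (σ * w * y)‖ * ‖V y‖ * ‖ν y w‖ := by rw [norm_mul, norm_mul]
      _ ≤ Real.exp (|w₀.re| * |y|) * ‖V y‖ * (C * Real.exp (b * |y|)) := by
          gcongr
          exact hν y w hw
      _ = C * (Real.exp ((|w₀.re| + b) * |y|) * ‖V y‖) := by
          rw [add_mul, Real.exp_add]; ring
  refine ⟨fun t ht => ?_, differentiableOn_integral_of_locally_dominated
    (fun t ht => (hmeas t ht).aestronglyMeasurable) (fun y => ?_) fun t ht => ?_⟩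
  · obtain ⟨r, hr, -, g, hg, hle⟩ := hdom t ht
    exact hg.mono' (hmeas t ht).aestronglyMeasurable
      (.of_forall (hle t (Metric.mem_closedBall_self hr.le)))
  · exact (DifferentiableOn.mul (by fun_prop) (by fun_prop)).mul (hhol y)
  · obtain ⟨r, hr, hrU, g, hg, hle⟩ := hdom t ht
    exact ⟨r, hr, hrU, g, hg.integrableOn, hle⟩

/-- If `ν(·,t)` is holomorphic in `t` and its derivative at `0` does not depend on `t`, then
`D(0)` and `D'(0)` are holomorphic in `t` on the punctured strip. -/
theorem differentiableOn_D_zero {a : ℝ} {V : ℝ → ℂ} (hV : Continuous V)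
    (hVL2 : Integrable fun x : ℝ => Real.exp (4 * a * |x|) * ‖V x‖ ^ 2) {ν : ℝ → ℂ → ℂ}
    (hdiff : ∀ t : ℂ, |t.re| < a → Differentiable ℝ fun x => ν x t)
    {c : ℂ} (hderiv : ∀ t : ℂ, |t.re| < a → deriv (fun x => ν x t) 0 = c)
    (hhol : ∀ x, DifferentiableOn ℂ (ν x) {t : ℂ | |t.re| < a})
    (hbound : ∀ K : Set ℂ, K ⊆ {t : ℂ | |t.re| < a} → IsCompact K →
      ∃ C b : ℝ, (∀ t ∈ K, b < 2 * a - |t.re|) ∧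
        ∀ x : ℝ, ∀ t ∈ K, ‖ν x t‖ ≤ C * Real.exp (b * |x|)) :
    DifferentiableOn ℂ (fun t => D t V (fun x => ν x t) 0) {t : ℂ | |t.re| < a ∧ t ≠ 0} ∧
    DifferentiableOn ℂ (fun t => deriv (D t V fun x => ν x t) 0)
      {t : ℂ | |t.re| < a ∧ t ≠ 0} := by
  have hsub : {t : ℂ | |t.re| < a ∧ t ≠ 0} ⊆ {t : ℂ | |t.re| < a} := fun _ h => h.1
  have hcont := fun t ht => (hdiff t ht).continuous
  obtain ⟨hneg, hA⟩ := differentiableOn_integral_exp_mul hV hVL2 hcont hhol hbound (-1)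
    (by simp) (Ici 0)
  obtain ⟨hpos, hB⟩ := differentiableOn_integral_exp_mul hV hVL2 hcont hhol hbound 1
    (by simp) (Iic 0)
  simp only [Complex.ofReal_neg, Complex.ofReal_one, neg_mul, one_mul] at hneg hA hpos hB
  have hinv : DifferentiableOn ℂ (fun t : ℂ => 1 / (2 * t)) {t : ℂ | |t.re| < a ∧ t ≠ 0} :=
    (differentiableOn_const _).div (by fun_prop) fun t ht => mul_ne_zero two_ne_zero ht.2
  constructor
  · simp only [D_zero, neg_mul]
    exact (((hhol 0).mono hsub).add (hinv.mul (hA.mono hsub))).add (hinv.mul (hB.mono hsub))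
  · refine DifferentiableOn.congr ((((hA.mono hsub).const_mul (1 / 2)).const_add c).sub
      ((hB.mono hsub).const_mul (1 / 2))) fun t ht => ?_
    rw [deriv_D_zero ht.2 hV (hdiff t ht.1) (by simpa using hneg t ht.1) (hpos t ht.1),
      hderiv t ht.1]
    simp only [neg_mul, Pi.sub_apply]

/-- Let `a > 0`, `V` continuous with `e^{2a|x|}V ∈ L²(ℝ)`, and let
`ν₁(x,t), ν₂(x,t)` be, for each `t` with `|Re t| < a`, the C² solutions in `x` of
`μ'' + (-t² - V)μ = 0` with standard initial data at `0`, jointly continuous together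
with their `x`-derivatives, holomorphic in `t` for fixed `x`, and satisfying on each
compact `K ⊂ {|Re t| < a}` a bound `|νᵢ| + |∂ₓνᵢ| ≤ C_K e^{b_K|x|}` with
`b_K < 2a - sup_K |Re t|`.  Then `t ↦ 𝔻(-t², ν₁(·,t), ν₂(·,t))` is holomorphic on
`{t : |Re t| < a, t ≠ 0}`. -/
theorem statement11 (a : ℝ) (ha : 0 < a) (V : ℝ → ℂ) (hV : Continuous V)
    (hVL2 : Integrable (fun x : ℝ => Real.exp (4 * a * |x|) * ‖V x‖ ^ 2))
    (ν₁ ν₂ : ℝ → ℂ → ℂ)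
    (hC2 : ∀ t : ℂ, |t.re| < a →
      ContDiff ℝ 2 (fun x => ν₁ x t) ∧ ContDiff ℝ 2 (fun x => ν₂ x t))
    (hode : ∀ t : ℂ, |t.re| < a → ∀ x : ℝ,
      deriv (deriv (fun x => ν₁ x t)) x + (-t ^ 2 - V x) * ν₁ x t = 0 ∧
      deriv (deriv (fun x => ν₂ x t)) x + (-t ^ 2 - V x) * ν₂ x t = 0)
    (hinit : ∀ t : ℂ, |t.re| < a →
      ν₁ 0 t = 1 ∧ deriv (fun x => ν₁ x t) 0 = 0 ∧
      ν₂ 0 t = 0 ∧ deriv (fun x => ν₂ x t) 0 = 1)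
    (hcont : ContinuousOn (fun p : ℝ × ℂ => ν₁ p.1 p.2) {p | |p.2.re| < a} ∧
             ContinuousOn (fun p : ℝ × ℂ => ν₂ p.1 p.2) {p | |p.2.re| < a} ∧
             ContinuousOn (fun p : ℝ × ℂ => deriv (fun x => ν₁ x p.2) p.1) {p | |p.2.re| < a} ∧
             ContinuousOn (fun p : ℝ × ℂ => deriv (fun x => ν₂ x p.2) p.1) {p | |p.2.re| < a})
    (hhol : ∀ x : ℝ,
      DifferentiableOn ℂ (fun t => ν₁ x t) {t : ℂ | |t.re| < a} ∧
      DifferentiableOn ℂ (fun t => ν₂ x t) {t : ℂ | |t.re| < a})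
    (hbound : ∀ K : Set ℂ, K ⊆ {t : ℂ | |t.re| < a} → IsCompact K →
      ∃ C b : ℝ, (∀ t ∈ K, b < 2 * a - |t.re|) ∧
        ∀ x : ℝ, ∀ t ∈ K,
          ‖ν₁ x t‖ + ‖deriv (fun x => ν₁ x t) x‖ ≤ C * Real.exp (b * |x|) ∧
          ‖ν₂ x t‖ + ‖deriv (fun x => ν₂ x t) x‖ ≤ C * Real.exp (b * |x|)) :
    DifferentiableOn ℂ (fun t : ℂ => DD t V (fun x => ν₁ x t) (fun x => ν₂ x t))
      {t : ℂ | |t.re| < a ∧ t ≠ 0} := by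
  have hdom : ∀ {u v w : ℝ}, 0 ≤ v → u + v ≤ w → u ≤ w := fun hv h => by linarith
  obtain ⟨h₁, h₁'⟩ := differentiableOn_D_zero hV hVL2
    (fun t ht => (hC2 t ht).1.differentiable (by norm_num)) (fun t ht => (hinit t ht).2.1)
    (fun x => (hhol x).1) fun K hKU hK => by
      obtain ⟨C, b, hb, h⟩ := hbound K hKU hK
      exact ⟨C, b, hb, fun x t ht => hdom (norm_nonneg _) (h x t ht).1⟩
  obtain ⟨h₂, h₂'⟩ := differentiableOn_D_zero hV hVL2
    (fun t ht => (hC2 t ht).2.differentiable (by norm_num)) (fun t ht => (hinit t ht).2.2.2)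
    (fun x => (hhol x).2) fun K hKU hK => by
      obtain ⟨C, b, hb, h⟩ := hbound K hKU hK
      exact ⟨C, b, hb, fun x t ht => hdom (norm_nonneg _) (h x t ht).2⟩
  exact (h₁.mul h₂').sub (h₁'.mul h₂)
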